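/- For each slim semimodular lattice L with at least three elements, there exists a congruence-preserving extension K of L such that K is a slim rectangular lattice and length(K) = length(L). -/

import Mathlib

/-- A congruence of a lattice: an equivalence relation compatible with `⊔` and `⊓`. -/
structure LatCon (M : Type*) [Lattice M] where
  r : M → M → Prop
  refl : ∀ a, r a a
  symm : ∀ {a b}, r a b → r b a
  trans : ∀ {a b c}, r a b → r b c → r a c
  sup : ∀ {a b c d}, r a b → r c d → r (a ⊔ c) (b ⊔ d)
  inf : ∀ {a b c d}, r a b → r c d → r (a ⊓ c) (b ⊓ d)

/-- Restriction of a congruence along an (injective) lattice homomorphism; for a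
sublattice inclusion this is `Θ ↦ Θ ∩ (L × L)`. -/
def LatCon.restrict {A B : Type*} [Lattice A] [Lattice B] (f : LatticeHom A B)
    (Θ : LatCon B) : LatCon A where
  r a b := Θ.r (f a) (f b)
  refl a := Θ.refl (f a)
  symm h := Θ.symm h
  trans h₁ h₂ := Θ.trans h₁ h₂
  sup h₁ h₂ := by simpa [map_sup] using Θ.sup h₁ h₂
  inf h₁ h₂ := by simpa [map_inf] using Θ.inf h₁ h₂

/-- A lattice is (upper) semimodular if `x ⊓ y ⋖ x` implies `y ⋖ x ⊔ y`. -/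
def Semimodular (L : Type*) [Lattice L] : Prop :=
  ∀ x y : L, x ⊓ y ⋖ x → y ⋖ x ⊔ y

/-- A finite lattice is slim if its poset of nonzero join-irreducible elements is the
union of two chains. -/
def Slim (L : Type*) [Lattice L] : Prop :=
  ∃ C D : Set L, IsChain (· ≤ ·) C ∧ IsChain (· ≤ ·) D ∧
    {a : L | SupIrred a} = C ∪ D

/-- A finite semimodular lattice is slim rectangular if its poset of nonzero
join-irreducible elements is the union of two nonempty chains whose elements are
pairwise incomparable across the two chains. -/
def SlimRectangular (L : Type*) [Lattice L] : Prop :=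
  Semimodular L ∧
  ∃ C D : Set L, C.Nonempty ∧ D.Nonempty ∧
    IsChain (· ≤ ·) C ∧ IsChain (· ≤ ·) D ∧
    {a : L | SupIrred a} = C ∪ D ∧
    ∀ c ∈ C, ∀ d ∈ D, ¬(c ≤ d) ∧ ¬(d ≤ c)

/-! ### One-point extensions -/

/-- The lattice `L` with one new element `pt` such that `a < pt < c`. -/
inductive PtExt {L : Type u} [Lattice L] (a c : L) (h : a < c) : Type u
  | of : L → PtExt a c h
  | pt : PtExt a c h

namespace PtExt

variable {L : Type u} [Lattice L] {a b c : L} {h : a < c}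

/-- The order of the extension. -/
def le : PtExt a c h → PtExt a c h → Prop
  | .of y, .of z => y ≤ z
  | .of y, .pt => y ≤ a
  | .pt, .of z => c ≤ z
  | .pt, .pt => True

open Classical in
/-- The join of the extension. -/
noncomputable def sup' : PtExt a c h → PtExt a c h → PtExt a c h
  | .of y, .of z => of (y ⊔ z)
  | .of y, .pt => if y ≤ a then pt else of (y ⊔ c)
  | .pt, .of y => if y ≤ a then pt else of (y ⊔ c)
  | .pt, .pt => pt

open Classical in
/-- The meet of the extension. -/
noncomputable def inf' : PtExt a c h → PtExt a c h → PtExt a c h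
  | .of y, .of z => of (y ⊓ z)
  | .of y, .pt => if c ≤ y then pt else of (y ⊓ a)
  | .pt, .of y => if c ≤ y then pt else of (y ⊓ a)
  | .pt, .pt => pt

noncomputable instance : Lattice (PtExt a c h) where
  le := le
  le_refl u := by cases u <;> simp [le]
  le_trans u v w := by
    have := h.le
    cases u <;> cases v <;> cases w <;> simp only [le] <;> grind
  le_antisymm u v := by
    have := h.not_ge
    cases u <;> cases v <;> simp only [le] <;> grind
  sup := sup'
  inf := inf'
  le_sup_left u v := by
    cases u <;> cases v <;> simp only [sup'] <;> (try split_ifs) <;> simp_all [le]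
  le_sup_right u v := by
    cases u <;> cases v <;> simp only [sup'] <;> (try split_ifs) <;> simp_all [le]
  sup_le u v w := by
    cases u <;> cases v <;> cases w <;> simp only [sup'] <;> (try split_ifs) <;> simp_all [le]
  inf_le_left u v := by
    cases u <;> cases v <;> simp only [inf'] <;> (try split_ifs) <;> simp_all [le]
  inf_le_right u v := by
    cases u <;> cases v <;> simp only [inf'] <;> (try split_ifs) <;> simp_all [le]
  le_inf u v w := by
    cases u <;> cases v <;> cases w <;> simp only [inf'] <;> (try split_ifs) <;> simp_all [le]

@[simp] theorem of_le_of {y z : L} : (of y : PtExt a c h) ≤ of z ↔ y ≤ z := Iff.rfl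
@[simp] theorem of_le_pt {y : L} : (of y : PtExt a c h) ≤ pt ↔ y ≤ a := Iff.rfl
@[simp] theorem pt_le_of {y : L} : (pt : PtExt a c h) ≤ of y ↔ c ≤ y := Iff.rfl
@[simp] theorem of_lt_of {y z : L} : (of y : PtExt a c h) < of z ↔ y < z := by
  simp [lt_iff_le_not_ge]
@[simp] theorem of_lt_pt {y : L} : (of y : PtExt a c h) < pt ↔ y ≤ a := by
  simp only [lt_iff_le_not_ge, of_le_pt, pt_le_of, and_iff_left_iff_imp]
  intro h1 h2
  exact h.not_ge (h2.trans h1)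
@[simp] theorem pt_lt_of {y : L} : (pt : PtExt a c h) < of y ↔ c ≤ y := by
  simp only [lt_iff_le_not_ge, of_le_pt, pt_le_of, and_iff_left_iff_imp]
  intro h1 h2
  exact h.not_ge (h1.trans h2)
@[simp] theorem of_sup_of {y z : L} : (of y ⊔ of z : PtExt a c h) = of (y ⊔ z) := rfl
@[simp] theorem of_inf_of {y z : L} : (of y ⊓ of z : PtExt a c h) = of (y ⊓ z) := rfl
theorem pt_sup_of_le {y : L} (hy : y ≤ a) : (pt ⊔ of y : PtExt a c h) = pt := if_pos hy
theorem pt_sup_of_not {y : L} (hy : ¬ y ≤ a) : (pt ⊔ of y : PtExt a c h) = of (y ⊔ c) := if_neg hy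
theorem pt_inf_of_le {y : L} (hy : c ≤ y) : (pt ⊓ of y : PtExt a c h) = pt := if_pos hy
theorem pt_inf_of_not {y : L} (hy : ¬ c ≤ y) : (pt ⊓ of y : PtExt a c h) = of (y ⊓ a) := if_neg hy

/-- The embedding. -/
def emb (a c : L) (h : a < c) : LatticeHom L (PtExt a c h) where
  toFun := of
  map_sup' _ _ := rfl
  map_inf' _ _ := rfl

@[simp] theorem emb_apply (y : L) : emb a c h y = of y := rfl

theorem emb_injective : Function.Injective (emb a c h) := fun y z e => by
  simpa using e

instance [Finite L] : Finite (PtExt a c h) :=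
  Finite.of_surjective (fun o : Option L => o.elim pt of) (by
    rintro (y | _)
    · exact ⟨some y, rfl⟩
    · exact ⟨none, rfl⟩)

/-! Length -/

theorem krullDim_eq (hab : a < b) (hbc : b < c) :
    Order.krullDim (PtExt a c h) = Order.krullDim L := by
  apply le_antisymm
  · refine Order.krullDim_le_of_strictMono
      (fun u : PtExt a c h => match u with | .of y => y | .pt => b) ?_
    rintro (y | _) (z | _) hyz <;> simp at hyz ⊢
    · exact hyz
    · exact hyz.trans_lt hab
    · exact hbc.trans_le hyz
  · exact Order.krullDim_le_of_strictMono (fun y => (of y : PtExt a c h)) (fun y z => by simp)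

/-! Semimodularity -/

theorem of_covBy_of {y z : L} (hab : a < b) (hbc : b < c) :
    (of y : PtExt a c h) ⋖ of z ↔ y ⋖ z := by
  constructor
  · rintro ⟨h1, h2⟩
    refine ⟨by simpa using h1, fun w hw hw' => h2 (c := of w) (by simpa) (by simpa)⟩
  · rintro ⟨h1, h2⟩
    refine ⟨by simpa using h1, ?_⟩
    rintro (w | _) hw hw'
    · exact h2 (by simpa using hw) (by simpa using hw')
    · simp at hw hw'
      exact h2 (hw.trans_lt hab) (hbc.trans_le hw')

theorem of_covBy_pt {y : L} : (of y : PtExt a c h) ⋖ pt ↔ y = a := by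
  constructor
  · rintro ⟨h1, h2⟩
    simp at h1
    by_contra hne
    exact h2 (c := of a) (by simpa using lt_of_le_of_ne h1 hne) (by simp)
  · rintro rfl
    refine ⟨by simp, ?_⟩
    rintro (w | _) hw hw'
    · simp at hw hw'
      exact hw.not_ge hw'
    · simp at hw'

theorem pt_covBy_of {y : L} : (pt : PtExt a c h) ⋖ of y ↔ y = c := by
  constructor
  · rintro ⟨h1, h2⟩
    simp at h1
    by_contra hne
    exact h2 (c := of c) (by simp) (by simpa using lt_of_le_of_ne h1 (Ne.symm hne))
  · rintro rfl
    refine ⟨by simp, ?_⟩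
    rintro (w | _) hw hw'
    · simp at hw hw'
      exact hw'.not_ge hw
    · simp at hw

theorem semimodular (hL : Semimodular L) (hab : a ⋖ b) (hbc : b ⋖ c)
    (ha : ∀ y, a < y → b ≤ y) : Semimodular (PtExt a c h) := by
  rintro (y | _) (z | _) hyz
  · rw [of_inf_of, of_covBy_of hab.lt hbc.lt] at hyz
    rw [of_sup_of, of_covBy_of hab.lt hbc.lt]
    exact hL _ _ hyz
  · rw [inf_comm] at hyz
    rw [sup_comm]
    by_cases hy : c ≤ y
    · rw [pt_inf_of_le hy, pt_covBy_of] at hyz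
      subst hyz
      rw [pt_sup_of_not h.not_ge, sup_idem, pt_covBy_of]
    · rw [pt_inf_of_not hy, of_covBy_of hab.lt hbc.lt] at hyz
      have hya : ¬ y ≤ a := fun hle => hyz.lt.ne (inf_eq_left.2 hle)
      have h1 := hL _ _ hyz
      rw [pt_sup_of_not hya, pt_covBy_of]
      have h2 : b ≤ y ⊔ a := ha _ h1.lt
      have h3 : b = y ⊔ a := by
        rcases h2.lt_or_eq with h4 | h4
        · exact absurd h4 (h1.2 hab.lt)
        · exact h4
      rw [sup_eq_right]
      exact le_sup_left.trans (h3.symm.le.trans hbc.le)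
  · by_cases hz : c ≤ z
    · rw [pt_inf_of_le hz] at hyz
      exact absurd hyz.lt (lt_irrefl _)
    · rw [pt_inf_of_not hz, of_covBy_pt] at hyz
      have haz : a ≤ z := inf_eq_right.1 hyz
      rcases haz.lt_or_eq with h1 | rfl
      · have hbz : b ≤ z := ha _ h1
        rw [pt_sup_of_not h1.not_ge, of_covBy_of hab.lt hbc.lt, sup_comm]
        apply hL
        have : c ⊓ z = b := by
          have h2 : b ≤ c ⊓ z := le_inf hbc.le hbz
          rcases h2.lt_or_eq with h3 | h3
          · rcases (inf_le_left : c ⊓ z ≤ c).lt_or_eq with h4 | h4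
            · exact absurd h4 (hbc.2 h3)
            · exact absurd (inf_eq_left.1 h4) hz
          · exact h3.symm
        rw [this]
        exact hbc
      · rw [pt_sup_of_le le_rfl, of_covBy_pt]
  · rw [inf_idem] at hyz
    exact absurd hyz.lt (lt_irrefl _)

/-! Join-irreducible elements -/

theorem supIrred_pt : SupIrred (pt : PtExt a c h) := by
  refine ⟨fun hm => ?_, ?_⟩
  · have := hm (b := of a) (by simp)
    exact h.not_ge (by simpa using this)
  · rintro (y | _) (z | _) hyz
    · simp at hyz
    · exact Or.inr rfl
    · exact Or.inl rfl
    · exact Or.inl rfl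

theorem supIrred_of_iff (hab : a < b) (hbc : b < c) {y : L} :
    SupIrred (of y : PtExt a c h) ↔ SupIrred y ∧ y ≠ c := by
  constructor
  · rintro ⟨h1, h2⟩
    refine ⟨⟨fun hm => h1 ?_, fun u v huv => ?_⟩, ?_⟩
    · rintro (z | _) hz
      · simp at hz ⊢
        exact hm hz
      · simp at hz ⊢
        exact (hm (h.le.trans hz))
    · have := @h2 (of u) (of v) (by simp [huv])
      simpa using this
    · rintro rfl
      have := @h2 pt (of b) (by rw [pt_sup_of_not hab.not_ge, sup_eq_right.2 hbc.le])
      simp [hbc.ne] at this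
  · rintro ⟨⟨h1, h2⟩, h3⟩
    have key : ∀ z, (pt ⊔ of z : PtExt a c h) = of y → (of z : PtExt a c h) = of y := by
      intro z hz
      by_cases hza : z ≤ a
      · simp [pt_sup_of_le hza] at hz
      · rw [pt_sup_of_not hza] at hz
        simp at hz
        rcases h2 hz with h4 | h4
        · rw [h4]
        · exact absurd h4.symm h3
    refine ⟨fun hm => h1 fun z hz => ?_, ?_⟩
    · exact hm (b := of z) (by simpa)
    · rintro (u | _) (v | _) huv
      · simp at huv ⊢
        exact h2 huv
      · rw [sup_comm] at huv
        exact Or.inl (key _ huv)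
      · exact Or.inr (key _ huv)
      · simp at huv

theorem slim {C D : Set L} (hab : a < b) (hbc : b < c) (hC : IsChain (· ≤ ·) C)
    (hD : IsChain (· ≤ ·) D) (hJ : {j : L | SupIrred j} = C ∪ D) (hcD : c ∈ D)
    (hd : ∀ d ∈ D, d < c → d ≤ a) : Slim (PtExt a c h) := by
  refine ⟨of '' (C \ {c}), insert pt (of '' (D \ {c})), ?_, ?_, ?_⟩
  · rintro _ ⟨y, hy, rfl⟩ _ ⟨z, hz, rfl⟩ hne
    simpa using hC hy.1 hz.1 (fun e => hne (by rw [e]))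
  · apply IsChain.insert
    · rintro _ ⟨y, hy, rfl⟩ _ ⟨z, hz, rfl⟩ hne
      simpa using hD hy.1 hz.1 (fun e => hne (by rw [e]))
    · rintro _ ⟨y, hy, rfl⟩ -
      have hyc : y ≠ c := hy.2
      rcases hD hcD hy.1 hyc.symm with h1 | h1
      · exact Or.inl (by simpa using h1)
      · exact Or.inr (by simpa using hd y hy.1 (lt_of_le_of_ne h1 hyc))
  · ext u
    rcases u with y | _
    · have : SupIrred y ↔ y ∈ C ∨ y ∈ D := by
        have := Set.ext_iff.1 hJ y
        simpa using this
      simp [supIrred_of_iff hab hbc, this]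
      tauto
    · simp [supIrred_pt]

end PtExt

/-- Comparable pairs of join-irreducible elements. -/
def jpairs (L : Type u) [Lattice L] : Set (L × L) :=
  {p | SupIrred p.1 ∧ SupIrred p.2 ∧ p.1 < p.2}

theorem PtExt.jpairs_lt {L : Type u} [Lattice L] [Finite L] {a b c p : L} {h : a < c}
    (hab : a < b) (hbc : b < c) (hc : SupIrred c) (hp : SupIrred p) (hpc : p < c)
    (hpa : ¬ p ≤ a) : (jpairs (PtExt a c h)).ncard < (jpairs L).ncard := by
  let φ : PtExt a c h → L := fun u => match u with | .of y => y | .pt => c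
  have hφ1 : ∀ u : PtExt a c h, SupIrred u → SupIrred (φ u) := by
    rintro (y | _) hu
    · exact ((supIrred_of_iff hab hbc).1 hu).1
    · exact hc
  have hφ2 : ∀ u v : PtExt a c h, SupIrred u → SupIrred v → u < v → φ u < φ v := by
    rintro (y | _) (z | _) hu hv huv <;> simp at huv <;> simp only [φ]
    · exact huv
    · exact huv.trans_lt h
    · exact lt_of_le_of_ne huv ((supIrred_of_iff hab hbc).1 hv).2.symm
  have hφ3 : ∀ u v : PtExt a c h, SupIrred u → SupIrred v → φ u = φ v → u = v := by
    rintro (y | _) (z | _) hu hv huv <;> simp only [φ] at huv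
    · rw [huv]
    · exact absurd huv ((supIrred_of_iff hab hbc).1 hu).2
    · exact absurd huv.symm ((supIrred_of_iff hab hbc).1 hv).2
    · rfl
  have hinj : Set.InjOn (Prod.map φ φ) (jpairs (PtExt a c h)) := by
    rintro ⟨u, v⟩ ⟨h1, h2, -⟩ ⟨u', v'⟩ ⟨h1', h2', -⟩ he
    simp only [Prod.map_apply, Prod.mk.injEq] at he
    exact Prod.ext (hφ3 _ _ h1 h1' he.1) (hφ3 _ _ h2 h2' he.2)
  rw [← hinj.ncard_image]
  apply Set.ncard_lt_ncard _ (Set.toFinite _)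
  rw [Set.ssubset_iff_of_subset]
  · refine ⟨(p, c), ⟨hp, hc, hpc⟩, ?_⟩
    rintro ⟨⟨u, v⟩, ⟨h1, h2, h3⟩, he⟩
    simp only [Prod.map_apply, Prod.mk.injEq] at he
    obtain ⟨he1, he2⟩ := he
    have hv : v = pt := hφ3 _ _ h2 supIrred_pt he2
    subst hv
    rcases u with y | _
    · simp only [φ] at he1
      subst he1
      exact hpa (by simpa using h3)
    · exact lt_irrefl _ h3
  · rintro _ ⟨⟨u, v⟩, ⟨h1, h2, h3⟩, rfl⟩
    exact ⟨hφ1 _ h1, hφ1 _ h2, hφ2 _ _ h1 h2 h3⟩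

/-! ### Congruences -/

/-- `f` exhibits a congruence-preserving extension. -/
def CPE {L K : Type u} [Lattice L] [Lattice K] (f : LatticeHom L K) : Prop :=
  Function.Injective f ∧ Function.Bijective (LatCon.restrict f) ∧
    ∀ Θ₁ Θ₂ : LatCon K,
      ((∀ x y : K, Θ₁.r x y → Θ₂.r x y) ↔
        (∀ x y : L, (LatCon.restrict f Θ₁).r x y → (LatCon.restrict f Θ₂).r x y))

theorem LatCon.ext' {L : Type u} [Lattice L] {Θ₁ Θ₂ : LatCon L}
    (h : ∀ x y, Θ₁.r x y ↔ Θ₂.r x y) : Θ₁ = Θ₂ := by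
  cases Θ₁
  cases Θ₂
  congr
  funext x y
  exact propext (h x y)

theorem CPE.comp {L K M : Type u} [Lattice L] [Lattice K] [Lattice M] {g : LatticeHom K M}
    {f : LatticeHom L K} (hg : CPE g) (hf : CPE f) : CPE (g.comp f) := by
  obtain ⟨g1, g2, g3⟩ := hg
  obtain ⟨f1, f2, f3⟩ := hf
  exact ⟨g1.comp f1, f2.comp g2, fun Θ₁ Θ₂ => (g3 Θ₁ Θ₂).trans (f3 _ _)⟩

theorem CPE.id (L : Type u) [Lattice L] : CPE (LatticeHom.id L) :=
  ⟨fun _ _ h => h, Function.bijective_id, fun _ _ => Iff.rfl⟩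

namespace PtExt

variable {L : Type u} [Lattice L] {a b c : L} {h : a < c}

theorem con_pt (hab : a < b) (hbc : b < c) (Θ : LatCon (PtExt a c h)) (y : L) :
    Θ.r pt (of y) ↔ (Θ.r (of a) (of b) ∧ Θ.r (of c) (of y)) ∨
      (Θ.r (of b) (of c) ∧ Θ.r (of a) (of y)) := by
  have e1 : (pt ⊓ of b : PtExt a c h) = of a := by
    rw [pt_inf_of_not hbc.not_ge, inf_eq_right.2 hab.le]
  have e2 : (pt ⊔ of b : PtExt a c h) = of c := by
    rw [pt_sup_of_not hab.not_ge, sup_eq_right.2 hbc.le]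
  constructor
  · intro hy
    by_cases hcy : c ≤ y
    · left
      have h1 := Θ.inf hy (Θ.refl (of c))
      rw [pt_inf_of_le le_rfl, of_inf_of, inf_eq_right.2 hcy] at h1
      refine ⟨?_, Θ.trans (Θ.symm h1) hy⟩
      have h2 := Θ.inf h1 (Θ.refl (of b))
      rwa [e1, of_inf_of, inf_eq_right.2 hbc.le] at h2
    · right
      have h1 := Θ.inf (Θ.refl pt) hy
      rw [inf_idem, pt_inf_of_not hcy] at h1
      have h2 := Θ.sup h1 (Θ.refl (of a))
      rw [pt_sup_of_le le_rfl, of_sup_of, sup_eq_right.2 inf_le_right] at h2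
      refine ⟨?_, Θ.trans (Θ.symm h2) hy⟩
      have h3 := Θ.sup h2 (Θ.refl (of b))
      rw [e2, of_sup_of, sup_eq_right.2 hab.le] at h3
      exact Θ.symm h3
  · rintro (⟨h1, h2⟩ | ⟨h1, h2⟩)
    · have h3 := Θ.sup (Θ.refl pt) h1
      rw [e2, pt_sup_of_le le_rfl] at h3
      exact Θ.trans h3 h2
    · have h3 := Θ.inf (Θ.refl pt) h1
      rw [e1, pt_inf_of_le le_rfl] at h3
      exact Θ.trans (Θ.symm h3) h2

/-- The relation extending a congruence. -/
def extR (b : L) (Θ : LatCon L) : PtExt a c h → PtExt a c h → Prop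
  | .of y, .of z => Θ.r y z
  | .of y, .pt => (Θ.r a b ∧ Θ.r c y) ∨ (Θ.r b c ∧ Θ.r a y)
  | .pt, .of y => (Θ.r a b ∧ Θ.r c y) ∨ (Θ.r b c ∧ Θ.r a y)
  | .pt, .pt => True

theorem extR_symm {Θ : LatCon L} {u v : PtExt a c h} (huv : extR b Θ u v) : extR b Θ v u := by
  rcases u with y | _ <;> rcases v with z | _ <;> simp only [extR] at huv ⊢
  · exact Θ.symm huv
  · exact huv
  · exact huv

theorem extR_trans {Θ : LatCon L} {u v w : PtExt a c h} (huv : extR b Θ u v)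
    (hvw : extR b Θ v w) : extR b Θ u w := by
  have hs := @Θ.symm
  have ht := @Θ.trans
  rcases u with y | _ <;> rcases v with z | _ <;> rcases w with t | _ <;>
    simp only [extR] at huv hvw ⊢ <;> grind

theorem extR_sup {Θ : LatCon L} (hab : a < b) (hbc : b < c) (ha : ∀ y, a < y → b ≤ y)
    {u v : PtExt a c h} (huv : extR b Θ u v) (w : PtExt a c h) : extR b Θ (u ⊔ w) (v ⊔ w) := by
  have hb : ∀ z, ¬ z ≤ a → b ≤ z ⊔ a := fun z hz => ha _ (by simpa using hz)
  have hs : ∀ {y z : L}, Θ.r y z → ∀ w, Θ.r (y ⊔ w) (z ⊔ w) := fun hyz w =>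
    Θ.sup hyz (Θ.refl w)
  -- if `a ≡ z` with `z ≰ a`, then `a ≡ b`
  have hab' : ∀ z, ¬ z ≤ a → Θ.r a z → Θ.r a b := by
    intro z hz h1
    have h2 := Θ.inf (Θ.sup h1 (Θ.refl a)) (Θ.refl b)
    rwa [sup_idem, inf_eq_left.2 hab.le, inf_eq_right.2 (hb z hz)] at h2
  have key : ∀ y : L, ∀ w : PtExt a c h, extR b Θ (pt : PtExt a c h) (of y) →
      extR b Θ (pt ⊔ w : PtExt a c h) (of y ⊔ w) := by
    intro y w h1
    simp only [extR] at h1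
    rcases w with z | _
    · by_cases hz : z ≤ a
      · rw [pt_sup_of_le hz, of_sup_of]
        simp only [extR]
        rcases h1 with ⟨h1, h2⟩ | ⟨h1, h2⟩
        · have h3 := hs h2 z
          rw [sup_eq_left.2 (hz.trans h.le)] at h3
          exact Or.inl ⟨h1, h3⟩
        · have h3 := hs h2 z
          rw [sup_eq_left.2 hz] at h3
          exact Or.inr ⟨h1, h3⟩
      · rw [pt_sup_of_not hz, of_sup_of, sup_comm]
        simp only [extR]
        rcases h1 with ⟨h1, h2⟩ | ⟨h1, h2⟩
        · exact hs h2 z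
        · have h3 := hs (Θ.symm h1) (z ⊔ a)
          rw [sup_eq_right.2 (hb z hz), sup_comm, sup_assoc, sup_eq_right.2 h.le] at h3
          rw [sup_comm]
          refine Θ.trans h3 ?_
          rw [sup_comm]
          exact hs h2 z
    · rw [sup_idem, sup_comm]
      by_cases hy : y ≤ a
      · rw [pt_sup_of_le hy]
        trivial
      · rw [pt_sup_of_not hy]
        simp only [extR]
        left
        rcases h1 with ⟨h1, h2⟩ | ⟨h1, h2⟩
        · have h3 := hs h2 c
          rw [sup_idem] at h3
          exact ⟨h1, h3⟩
        · refine ⟨hab' y hy h2, ?_⟩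
          have h3 := hs h2 c
          rwa [sup_eq_right.2 h.le] at h3
  have key2 : ∀ y z : L, Θ.r y z → y ≤ a → ¬ z ≤ a → extR b Θ (pt : PtExt a c h) (of (z ⊔ c)) := by
    intro y z h1 hy hz
    have h2 := hs h1 a
    rw [sup_eq_right.2 hy] at h2
    have h3 := hs h2 c
    rw [sup_eq_right.2 h.le, sup_assoc, sup_eq_right.2 h.le] at h3
    exact Or.inl ⟨hab' (z ⊔ a) (by simpa using hz) h2, h3⟩
  rcases u with y | _ <;> rcases v with z | _
  · rcases w with w | _
    · exact hs huv w
    · rw [sup_comm, sup_comm (of z)]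
      by_cases hy : y ≤ a <;> by_cases hz : z ≤ a
      · rw [pt_sup_of_le hy, pt_sup_of_le hz]
        trivial
      · rw [pt_sup_of_le hy, pt_sup_of_not hz]
        exact key2 y z huv hy hz
      · rw [pt_sup_of_not hy, pt_sup_of_le hz]
        exact extR_symm (key2 z y (Θ.symm huv) hz hy)
      · rw [pt_sup_of_not hy, pt_sup_of_not hz]
        exact hs huv c
  · exact extR_symm (key y w (extR_symm huv))
  · exact key z w huv
  · cases (pt ⊔ w : PtExt a c h)
    · exact Θ.refl _
    · trivial

theorem extR_inf {Θ : LatCon L} (hab : a < b) (hbc : b < c) (hc : ∀ y, y < c → y ≤ b)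
    {u v : PtExt a c h} (huv : extR b Θ u v) (w : PtExt a c h) : extR b Θ (u ⊓ w) (v ⊓ w) := by
  have hb : ∀ z, ¬ c ≤ z → z ⊓ c ≤ b := fun z hz => hc _ (by simpa using hz)
  have hs : ∀ {y z : L}, Θ.r y z → ∀ w, Θ.r (y ⊓ w) (z ⊓ w) := fun hyz w =>
    Θ.inf hyz (Θ.refl w)
  -- if `c ≡ z` with `c ≰ z`, then `b ≡ c`
  have hbc' : ∀ z, ¬ c ≤ z → Θ.r c z → Θ.r b c := by
    intro z hz h1
    have h2 := Θ.sup (Θ.inf h1 (Θ.refl c)) (Θ.refl b)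
    rw [inf_idem, sup_eq_left.2 hbc.le, sup_eq_right.2 (hb z hz)] at h2
    exact Θ.symm h2
  have key : ∀ y : L, ∀ w : PtExt a c h, extR b Θ (pt : PtExt a c h) (of y) →
      extR b Θ (pt ⊓ w : PtExt a c h) (of y ⊓ w) := by
    intro y w h1
    simp only [extR] at h1
    rcases w with z | _
    · by_cases hz : c ≤ z
      · rw [pt_inf_of_le hz, of_inf_of]
        simp only [extR]
        rcases h1 with ⟨h1, h2⟩ | ⟨h1, h2⟩
        · have h3 := hs h2 z
          rw [inf_eq_left.2 hz] at h3
          exact Or.inl ⟨h1, h3⟩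
        · have h3 := hs h2 z
          rw [inf_eq_left.2 (h.le.trans hz)] at h3
          exact Or.inr ⟨h1, h3⟩
      · rw [pt_inf_of_not hz, of_inf_of, inf_comm]
        simp only [extR]
        rcases h1 with ⟨h1, h2⟩ | ⟨h1, h2⟩
        · have h3 := hs h1 (z ⊓ c)
          rw [inf_eq_right.2 (hb z hz), inf_comm, inf_assoc, inf_eq_right.2 h.le] at h3
          rw [inf_comm]
          refine Θ.trans h3 ?_
          rw [inf_comm]
          exact hs h2 z
        · exact hs h2 z
    · rw [inf_idem, inf_comm]
      by_cases hy : c ≤ y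
      · rw [pt_inf_of_le hy]
        trivial
      · rw [pt_inf_of_not hy]
        simp only [extR]
        right
        rcases h1 with ⟨h1, h2⟩ | ⟨h1, h2⟩
        · refine ⟨hbc' y hy h2, ?_⟩
          have h3 := hs h2 a
          rwa [inf_eq_right.2 h.le] at h3
        · have h3 := hs h2 a
          rw [inf_idem] at h3
          exact ⟨h1, h3⟩
  have key2 : ∀ y z : L, Θ.r y z → c ≤ y → ¬ c ≤ z → extR b Θ (pt : PtExt a c h) (of (z ⊓ a)) := by
    intro y z h1 hy hz
    have h2 := hs h1 c
    rw [inf_eq_right.2 hy] at h2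
    have h3 := hs h2 a
    rw [inf_eq_right.2 h.le, inf_assoc, inf_eq_right.2 h.le] at h3
    exact Or.inr ⟨hbc' (z ⊓ c) (by simpa using hz) h2, h3⟩
  rcases u with y | _ <;> rcases v with z | _
  · rcases w with w | _
    · exact hs huv w
    · rw [inf_comm, inf_comm (of z)]
      by_cases hy : c ≤ y <;> by_cases hz : c ≤ z
      · rw [pt_inf_of_le hy, pt_inf_of_le hz]
        trivial
      · rw [pt_inf_of_le hy, pt_inf_of_not hz]
        exact key2 y z huv hy hz
      · rw [pt_inf_of_not hy, pt_inf_of_le hz]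
        exact extR_symm (key2 z y (Θ.symm huv) hz hy)
      · rw [pt_inf_of_not hy, pt_inf_of_not hz]
        exact hs huv a
  · exact extR_symm (key y w (extR_symm huv))
  · exact key z w huv
  · cases (pt ⊓ w : PtExt a c h)
    · exact Θ.refl _
    · trivial

/-- The extension of a congruence. -/
def extCon (hab : a < b) (hbc : b < c) (ha : ∀ y, a < y → b ≤ y) (hc : ∀ y, y < c → y ≤ b)
    (Θ : LatCon L) : LatCon (PtExt a c h) where
  r := extR b Θ
  refl u := by
    cases u
    · exact Θ.refl _
    · trivial
  symm := extR_symm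
  trans := extR_trans
  sup {u v w t} h1 h2 := by
    refine extR_trans (extR_sup hab hbc ha h1 w) ?_
    rw [sup_comm, sup_comm v]
    exact extR_sup hab hbc ha h2 v
  inf {u v w t} h1 h2 := by
    refine extR_trans (extR_inf hab hbc hc h1 w) ?_
    rw [inf_comm, inf_comm v]
    exact extR_inf hab hbc hc h2 v

theorem cpe (hab : a < b) (hbc : b < c) (ha : ∀ y, a < y → b ≤ y)
    (hc : ∀ y, y < c → y ≤ b) : CPE (emb a c h) := by
  have hle : ∀ Θ₁ Θ₂ : LatCon (PtExt a c h),
      ((∀ x y, Θ₁.r x y → Θ₂.r x y) ↔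
        (∀ x y : L, (LatCon.restrict (emb a c h) Θ₁).r x y →
          (LatCon.restrict (emb a c h) Θ₂).r x y)) := by
    intro Θ₁ Θ₂
    refine ⟨fun H x y => H _ _, fun H => ?_⟩
    have H' : ∀ x y : L, Θ₁.r (of x) (of y) → Θ₂.r (of x) (of y) := H
    have H2 : ∀ y : L, Θ₁.r pt (of y) → Θ₂.r pt (of y) := by
      intro y
      rw [con_pt hab hbc, con_pt hab hbc]
      exact Or.imp (And.imp (H' _ _) (H' _ _)) (And.imp (H' _ _) (H' _ _))
    rintro (x | _) (y | _) hxy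
    · exact H' _ _ hxy
    · exact Θ₂.symm (H2 _ (Θ₁.symm hxy))
    · exact H2 _ hxy
    · exact Θ₂.refl _
  refine ⟨emb_injective, ⟨fun Θ₁ Θ₂ he => ?_, fun Θ => ?_⟩, hle⟩
  · refine LatCon.ext' fun x y => ⟨(hle Θ₁ Θ₂).2 ?_ x y, (hle Θ₂ Θ₁).2 ?_ x y⟩
    · rw [he]
      exact fun _ _ => id
    · rw [he]
      exact fun _ _ => id
  · exact ⟨extCon hab hbc ha hc Θ, LatCon.ext' fun x y => Iff.rfl⟩

end PtExt

/-! ### Existence of a good triple -/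

theorem le_of_supIrred {L : Type u} [Lattice L] [Finite L] {y z : L}
    (H : ∀ j, SupIrred j → j ≤ y → j ≤ z) : y ≤ z := by
  haveI : Nonempty L := ⟨y⟩
  haveI := Fintype.ofFinite L
  letI := Fintype.toBoundedOrder L
  obtain ⟨s, hs, hj⟩ := exists_supIrred_decomposition y
  rw [← hs]
  refine Finset.sup_le fun j hjs => H j (hj hjs) ?_
  rw [← hs]
  exact Finset.le_sup (f := id) hjs

theorem exists_lower {L : Type u} [Lattice L] [Finite L] {q : L} (hq : SupIrred q) :
    ∃ b, b ⋖ q ∧ ∀ y, y < q → y ≤ b := by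
  obtain ⟨z, hz⟩ := not_isMin_iff.1 hq.1
  obtain ⟨b, -, hb⟩ := exists_le_covBy_of_lt hz
  refine ⟨b, hb, fun y hy => ?_⟩
  by_contra hyb
  have h1 : b < y ⊔ b := by simpa using hyb
  have h2 : y ⊔ b ≤ q := sup_le hy.le hb.le
  rcases h2.lt_or_eq with h3 | h3
  · exact hb.2 h1 h3
  · rcases hq.2 h3 with h4 | h4
    · exact hy.ne h4
    · exact hb.ne h4

theorem exists_triple {L : Type u} [Lattice L] [Finite L] (hL : Semimodular L) {C D : Set L}
    (hC : IsChain (· ≤ ·) C) (hD : IsChain (· ≤ ·) D)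
    (hJ : {j : L | SupIrred j} = C ∪ D) (hdisj : Disjoint C D)
    (hpq : ∃ p ∈ C, ∃ q ∈ D, p < q) :
    ∃ a b c p : L, a ⋖ b ∧ b ⋖ c ∧ (∀ y, a < y → b ≤ y) ∧ (∀ y, y < c → y ≤ b) ∧
      c ∈ D ∧ (∀ d ∈ D, d < c → d ≤ a) ∧ SupIrred p ∧ p < c ∧ ¬ p ≤ a := by
  have hJ' : ∀ j, SupIrred j ↔ j ∈ C ∨ j ∈ D := fun j => Set.ext_iff.1 hJ j
  haveI : Nonempty L := ⟨hpq.choose⟩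
  haveI := Fintype.ofFinite L
  letI := Fintype.toBoundedOrder L
  -- minimal `q`
  obtain ⟨q, ⟨hqD, p, hpC, hpq'⟩, hqmin⟩ : ∃ q, (q ∈ D ∧ ∃ p ∈ C, p < q) ∧
      ∀ q', (q' ∈ D ∧ ∃ p ∈ C, p < q') → ¬ q' < q := by
    obtain ⟨p, hp, q, hq, hlt⟩ := hpq
    obtain ⟨m, hm, hmin⟩ := WellFounded.has_min (wellFounded_lt (α := L))
      {q | q ∈ D ∧ ∃ p ∈ C, p < q} ⟨q, hq, p, hp, hlt⟩
    exact ⟨m, hm, fun q' hq' => hmin q' hq'⟩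
  have hqJ : SupIrred q := (hJ' q).2 (Or.inr hqD)
  obtain ⟨b, hbq, hb⟩ := exists_lower hqJ
  -- `d0`, the largest element of `D ∪ {⊥}` below `q`
  obtain ⟨d0, hd0, hd0q, hd0max⟩ : ∃ d0, (d0 ∈ D ∨ d0 = ⊥) ∧ d0 < q ∧
      ∀ d ∈ D, d < q → d ≤ d0 := by
    by_cases hne : {d | d ∈ D ∧ d < q}.Nonempty
    · obtain ⟨m, hm⟩ := (Set.toFinite {d | d ∈ D ∧ d < q}).exists_maximal hne
      refine ⟨m, Or.inl hm.1.1, hm.1.2, fun d hd hdq => ?_⟩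
      rcases hD.total hd hm.1.1 with h1 | h1
      · exact h1
      · exact hm.2 ⟨hd, hdq⟩ h1
    · refine ⟨⊥, Or.inr rfl, lt_of_le_of_lt bot_le hpq', fun d hd hdq => ?_⟩
      exact absurd ⟨d, hd, hdq⟩ hne
  -- no element of `C` is below `d0`
  have hCd0 : ∀ p ∈ C, ¬ p ≤ d0 := by
    intro p hp hle
    rcases hd0 with h1 | rfl
    · rcases hle.lt_or_eq with h2 | rfl
      · exact hqmin d0 ⟨h1, p, hp, h2⟩ hd0q
      · exact Set.disjoint_left.1 hdisj hp h1
    · exact ((hJ' p).2 (Or.inl hp)).1 (by rw [le_bot_iff.1 hle]; exact isMin_bot)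
  obtain ⟨p', ⟨hp'C, hp'b⟩, hp'min⟩ : ∃ p', (p' ∈ C ∧ p' ⊔ d0 = b) ∧
      ∀ r ∈ C, r ⊔ d0 = b → ¬ r < p' := by
    obtain ⟨p0, hp0⟩ := (Set.toFinite {r | r ∈ C ∧ r < q}).exists_maximal ⟨p, hpC, hpq'⟩
    have h0 : p0 ⊔ d0 = b := by
      apply le_antisymm (sup_le (hb _ hp0.1.2) (hb _ hd0q))
      apply le_of_supIrred
      intro j hj hjb
      have hjq := hjb.trans_lt hbq.lt
      rcases (hJ' j).1 hj with h1 | h1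
      · refine le_sup_of_le_left ?_
        rcases hC.total h1 hp0.1.1 with h2 | h2
        · exact h2
        · exact hp0.2 ⟨h1, hjq⟩ h2
      · exact le_sup_of_le_right (hd0max j h1 hjq)
    obtain ⟨m, hm, hmin⟩ := WellFounded.has_min (wellFounded_lt (α := L))
      {r | r ∈ C ∧ r ⊔ d0 = b} ⟨p0, hp0.1.1, h0⟩
    exact ⟨m, hm, fun r hr hrb => hmin r ⟨hr, hrb⟩⟩
  have hp'J : SupIrred p' := (hJ' p').2 (Or.inl hp'C)
  have hp'le : p' ≤ b := hp'b ▸ le_sup_left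
  have hp'q : p' < q := hp'le.trans_lt hbq.lt
  obtain ⟨s, hsp, hs⟩ := exists_lower hp'J
  have hnot : ¬ p' ≤ s ⊔ d0 := by
    intro hle
    by_cases hne : {r | r ∈ C ∧ r < p'}.Nonempty
    · obtain ⟨m, hm⟩ := (Set.toFinite {r | r ∈ C ∧ r < p'}).exists_maximal hne
      have h1 : s ≤ m ⊔ d0 := by
        apply le_of_supIrred
        intro j hj hjs
        have hjp := hjs.trans_lt hsp.lt
        rcases (hJ' j).1 hj with h1 | h1
        · refine le_sup_of_le_left ?_
          rcases hC.total h1 hm.1.1 with h2 | h2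
          · exact h2
          · exact hm.2 ⟨h1, hjp⟩ h2
        · exact le_sup_of_le_right (hd0max j h1 (hjp.trans hp'q))
      refine hp'min m hm.1.1 ?_ hm.1.2
      apply le_antisymm
      · rw [← hp'b]
        exact sup_le_sup_right hm.1.2.le _
      · rw [← hp'b]
        exact sup_le (hle.trans (sup_le h1 le_sup_right)) le_sup_right
    · have h1 : s ≤ d0 := by
        apply le_of_supIrred
        intro j hj hjs
        have hjp := hjs.trans_lt hsp.lt
        rcases (hJ' j).1 hj with h1 | h1
        · exact absurd ⟨j, h1, hjp⟩ hne
        · exact hd0max j h1 (hjp.trans hp'q)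
      exact hCd0 p' hp'C (hle.trans (sup_le h1 le_rfl))
  have hab : s ⊔ d0 ⋖ b := by
    have h1 : p' ⊓ (s ⊔ d0) = s := by
      apply le_antisymm
      · apply hs
        exact lt_of_le_of_ne inf_le_left (fun e => hnot (inf_eq_left.1 e))
      · exact le_inf hsp.le le_sup_left
    have h2 := hL p' (s ⊔ d0) (by rw [h1]; exact hsp)
    rwa [← sup_assoc, sup_eq_left.2 hsp.le, hp'b] at h2
  refine ⟨s ⊔ d0, b, q, p', hab, hbq, ?_, hb, hqD, ?_, hp'J, hp'q, hnot⟩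
  · intro y hy
    by_contra hby
    apply hy.not_ge
    apply le_of_supIrred
    intro r hr hry
    rcases (hJ' r).1 hr with h1 | h1
    · rcases hC.total hp'C h1 with h2 | h2
      · exfalso
        apply hby
        rw [← hp'b]
        exact sup_le (h2.trans hry) (le_sup_right.trans hy.le)
      · rcases h2.lt_or_eq with h3 | rfl
        · exact le_sup_of_le_left (hs _ h3)
        · exfalso
          apply hby
          rw [← hp'b]
          exact sup_le hry (le_sup_right.trans hy.le)
    · rcases hD.total hqD h1 with h2 | h2
      · exact absurd (hbq.le.trans (h2.trans hry)) hby
      · rcases h2.lt_or_eq with h3 | rfl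
        · exact le_sup_of_le_right (hd0max r h1 h3)
        · exact absurd (hbq.le.trans hry) hby
  · intro d hd hdq
    exact le_sup_of_le_right (hd0max d hd hdq)

theorem exists_two_supIrred {L : Type u} [Lattice L] [Finite L] (hcard : 3 ≤ Nat.card L) :
    {j : L | SupIrred j}.Nontrivial := by
  by_contra hnt
  rw [Set.not_nontrivial_iff] at hnt
  let g : L → Prop := fun y => ∃ j, SupIrred j ∧ j ≤ y
  have hg : Function.Injective g := by
    have key : ∀ y z, g y = g z → y ≤ z := by
      intro y z hyz
      apply le_of_supIrred
      intro j hj hjy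
      have : g z := hyz ▸ (⟨j, hj, hjy⟩ : g y)
      obtain ⟨i, hi, hiz⟩ := this
      rwa [hnt hj hi]
    exact fun y z hyz => le_antisymm (key _ _ hyz) (key _ _ hyz.symm)
  have := Nat.card_le_card_of_injective g hg
  simp at this
  omega

theorem exists_good_chains {L : Type u} [Lattice L] (hslim : Slim L)
    (hnt : {j : L | SupIrred j}.Nontrivial) :
    ∃ C D : Set L, C.Nonempty ∧ D.Nonempty ∧ IsChain (· ≤ ·) C ∧ IsChain (· ≤ ·) D ∧
      {j : L | SupIrred j} = C ∪ D ∧ Disjoint C D := by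
  obtain ⟨C, D, hC, hD, hJ⟩ := hslim
  have key : ∀ E : Set L, IsChain (· ≤ ·) E → {j : L | SupIrred j} = E →
      ∃ C D : Set L, C.Nonempty ∧ D.Nonempty ∧ IsChain (· ≤ ·) C ∧ IsChain (· ≤ ·) D ∧
      {j : L | SupIrred j} = C ∪ D ∧ Disjoint C D := by
    intro E hE hJE
    rw [hJE] at hnt ⊢
    obtain ⟨x, hx, y, hy, hxy⟩ := hnt
    refine ⟨{x}, E \ {x}, ⟨x, rfl⟩, ⟨y, hy, hxy.symm⟩, IsChain.singleton,
      hE.mono Set.diff_subset, ?_, Set.disjoint_sdiff_right⟩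
    rw [Set.union_diff_cancel (by simpa using hx)]
  by_cases h1 : C.Nonempty
  · by_cases h2 : (D \ C).Nonempty
    · exact ⟨C, D \ C, h1, h2, hC, hD.mono Set.diff_subset, by rw [hJ, Set.union_diff_self],
        Set.disjoint_sdiff_right⟩
    · rw [Set.not_nonempty_iff_eq_empty, Set.diff_eq_empty] at h2
      exact key C hC (by rw [hJ, Set.union_eq_left.2 h2])
  · rw [Set.not_nonempty_iff_eq_empty] at h1
    exact key D hD (by rw [hJ, h1, Set.empty_union])

theorem exists_ext (n : ℕ) : ∀ (L : Type u) [Lattice L] [Finite L], Semimodular L → Slim L →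
    3 ≤ Nat.card L → (jpairs L).ncard = n →
    ∃ (K : Type u) (_ : Lattice K) (_ : Finite K), SlimRectangular K ∧
      Order.krullDim K = Order.krullDim L ∧ ∃ f : LatticeHom L K, CPE f := by
  induction n using Nat.strong_induction_on with
  | _ n ih =>
  intro L _ _ hL hslim hcard hn
  obtain ⟨C, D, hCne, hDne, hC, hD, hJ, hdisj⟩ :=
    exists_good_chains hslim (exists_two_supIrred hcard)
  have step : ∀ C D : Set L, IsChain (· ≤ ·) C → IsChain (· ≤ ·) D →
      {j : L | SupIrred j} = C ∪ D → Disjoint C D → (∃ p ∈ C, ∃ q ∈ D, p < q) →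
      ∃ (K : Type u) (_ : Lattice K) (_ : Finite K), SlimRectangular K ∧
      Order.krullDim K = Order.krullDim L ∧ ∃ f : LatticeHom L K, CPE f := by
    intro C D hC hD hJ hdisj hpq
    obtain ⟨a, b, c, p, hab, hbc, ha, hc, hcD, hd, hp, hpc, hpa⟩ :=
      exists_triple hL hC hD hJ hdisj hpq
    have h : a < c := hab.lt.trans hbc.lt
    have hcJ : SupIrred c := (Set.ext_iff.1 hJ c).2 (Or.inr hcD)
    have hlt := PtExt.jpairs_lt (h := h) hab.lt hbc.lt hcJ hp hpc hpa
    rw [hn] at hlt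
    obtain ⟨K, iK, fK, hK, hdim, f, hf⟩ := ih _ hlt (PtExt a c h)
      (PtExt.semimodular hL hab hbc ha) (PtExt.slim hab.lt hbc.lt hC hD hJ hcD hd)
      (hcard.trans (Nat.card_le_card_of_injective _ (PtExt.emb_injective (h := h)))) rfl
    exact ⟨K, iK, fK, hK, hdim.trans (PtExt.krullDim_eq hab.lt hbc.lt), f.comp (PtExt.emb a c h),
      hf.comp (PtExt.cpe hab.lt hbc.lt ha hc)⟩
  by_cases h1 : ∃ p ∈ C, ∃ q ∈ D, p < q
  · exact step C D hC hD hJ hdisj h1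
  by_cases h2 : ∃ p ∈ D, ∃ q ∈ C, p < q
  · exact step D C hD hC (by rw [hJ, Set.union_comm]) hdisj.symm h2
  refine ⟨L, inferInstance, inferInstance, ⟨hL, C, D, hCne, hDne, hC, hD, hJ, ?_⟩, rfl,
    LatticeHom.id L, CPE.id L⟩
  intro p hp q hq
  have hne : p ≠ q := fun e => Set.disjoint_left.1 hdisj hp (e ▸ hq)
  exact ⟨fun hle => h1 ⟨p, hp, q, hq, lt_of_le_of_ne hle hne⟩,
    fun hle => h2 ⟨q, hq, p, hp, lt_of_le_of_ne hle hne.symm⟩⟩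

/-- Gr\u00e4tzer–Knapp: every slim semimodular lattice `L` with at least three elements
has a congruence-preserving extension `K` which is a slim rectangular lattice of the
same length as `L`. -/
theorem slim_cong_preserving_rectangular_ext (L : Type u) [CompleteLattice L]
    [Fintype L] (hL : Semimodular L) (hslim : Slim L)
    (hcard : 3 ≤ Fintype.card L) :
    ∃ (K : Type u) (_ : CompleteLattice K) (_ : Fintype K),
      SlimRectangular K ∧
      Order.krullDim K = Order.krullDim L ∧
      ∃ f : LatticeHom L K, Function.Injective f ∧
        -- `K` is a congruence-preserving extension of `L`: the restriction map
        -- `Con K → Con L` is an order isomorphism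
        Function.Bijective (LatCon.restrict f) ∧
        ∀ Θ₁ Θ₂ : LatCon K,
          ((∀ x y : K, Θ₁.r x y → Θ₂.r x y) ↔
            (∀ x y : L, (LatCon.restrict f Θ₁).r x y →
              (LatCon.restrict f Θ₂).r x y)) := by
  obtain ⟨K, iK, fK, hK, hdim, f, hf⟩ := exists_ext _ L hL hslim
    (by rwa [Nat.card_eq_fintype_card]) rfl
  haveI : Nonempty L := Fintype.card_pos_iff.1 (by omega)
  haveI : Nonempty K := ‹Nonempty L›.map f
  letI := Fintype.ofFinite K
  letI := Fintype.toBoundedOrder K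
  exact ⟨K, Fintype.toCompleteLattice K, inferInstance, hK, hdim, f, hf⟩
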